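/- arXiv:2308.16580 — 3 statements merged into one kernel-verified Lean document; each statement's English description precedes it below -/
import Mathlib

section
/- (Zerner) Let g be an expanding linear similitude of ℝ^d with ‖g(x) − g(y)‖ = (1/r)‖x − y‖ for some r ∈ (0,1), let h_k(x) = s_k(x) + v_k for k = 0,…,m−1, where each s_k is a linear isometry of ℝ^d, v_k ∈ ℝ^d, and h_0 = id, and let F = {f_k = g⁻¹∘h_k : k = 0,…,m−1} be the resulting IFS of similitudes of ratio r, with attractor A. Assume the data are crystallographic: the subgroup L of (ℝ^d,+) generated by {v_0,…,v_{m−1}} is discrete and free of rank d (isomorphic to ℤ^d), g(L) ⊆ L and s_k(L) ⊆ L for every k, and the group S generated by {s_0,…,s_{m−1}} commutes with g in the sense that for every s ∈ S there is s' ∈ S with g∘s = s'∘g and vice versa. Then the weak separation condition holds: there exists ε > 0 such that every map h = f⁻¹∘g' with f, g' arbitrary finite compositions of maps from F and h ≠ id satisfies sup_{‖x‖ ≤ 1} ‖h(x) − x‖ ≥ ε. -/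
/-- Composition of the maps of an IFS along a word of indices:
`wordComp f [i₁,…,iₙ] = f i₁ ∘ ⋯ ∘ f iₙ`. -/
def wordComp {E : Type*} {m : ℕ} (f : Fin m → E → E) : List (Fin m) → E → E
  | [] => id
  | i :: w => f i ∘ wordComp f w

section

variable {E : Type*} [NormedAddCommGroup E] [NormedSpace ℝ E]

/-- A linear isometry equivalence mapping a discrete subgroup into itself maps it onto itself. -/
lemma LinearIsometryEquiv.symm_mem_of_mapsTo_discrete [ProperSpace E] {L : AddSubgroup E}
    [DiscreteTopology L] (σ : E ≃ₗᵢ[ℝ] E) (hσ : ∀ x ∈ L, σ x ∈ L) {x : E} (hx : x ∈ L) :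
    σ.symm x ∈ L := by
  have hfin : (Metric.closedBall (0 : E) ‖x‖ ∩ (L : Set E)).Finite :=
    Metric.finite_isBounded_inter_isClosed DiscreteTopology.isDiscrete
      Metric.isBounded_closedBall AddSubgroup.isClosed_of_discrete
  have hmaps : Set.MapsTo σ (Metric.closedBall (0 : E) ‖x‖ ∩ (L : Set E))
      (Metric.closedBall (0 : E) ‖x‖ ∩ (L : Set E)) := fun y hy => by
    refine ⟨?_, hσ y hy.2⟩
    have := hy.1
    simpa using this
  obtain ⟨y, hy, rfl⟩ :=
    ((hfin.injOn_iff_bijOn_of_mapsTo hmaps).1 σ.injective.injOn).surjOn ⟨by simp, hx⟩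
  simpa using hy.2

/-- The stabilizer property passes from a family of linear isometries to the group it generates. -/
lemma LinearIsometryEquiv.mem_of_mem_closure [ProperSpace E] {L : AddSubgroup E}
    [DiscreteTopology L] {T : Set (E ≃ₗᵢ[ℝ] E)} (hT : ∀ σ ∈ T, ∀ x ∈ L, σ x ∈ L)
    {σ : E ≃ₗᵢ[ℝ] E} (hσ : σ ∈ Subgroup.closure T) : ∀ x ∈ L, σ x ∈ L := by
  induction hσ using Subgroup.closure_induction with
  | mem σ h => exact hT σ h
  | one => exact fun x hx => hx
  | mul σ τ _ _ h₁ h₂ => exact fun x hx => h₁ _ (h₂ x hx)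
  | inv σ _ h => exact fun x hx => σ.symm_mem_of_mapsTo_discrete h hx

/-- A discrete subgroup has a positive lower bound on the norms of its nonzero elements. -/
lemma AddSubgroup.exists_pos_forall_norm_lt_eq_zero {E : Type*}
    [NormedAddCommGroup E] (L : AddSubgroup E) [DiscreteTopology L] :
    ∃ δ > 0, ∀ x ∈ L, ‖x‖ < δ → x = 0 := by
  obtain ⟨δ, hδ, h⟩ := Metric.exists_ball_inter_eq_singleton_of_mem_discrete
    (s := (L : Set E)) DiscreteTopology.isDiscrete L.zero_mem
  refine ⟨δ, hδ, fun x hx hlt => ?_⟩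
  have : x ∈ Metric.ball (0 : E) δ ∩ (L : Set E) := ⟨by simpa using hlt, hx⟩
  rw [h] at this
  exact this

/-- A discrete subgroup which is free of full rank spans the space. -/
lemma span_eq_top_of_discrete_of_equiv [FiniteDimensional ℝ E] {s : Set E} {d : ℕ}
    (hd : Module.finrank ℝ E = d) (hdisc : DiscreteTopology (AddSubgroup.closure s))
    (e : AddSubgroup.closure s ≃+ (Fin d → ℤ)) :
    Submodule.span ℝ s = ⊤ := by
  have hL : (Submodule.span ℤ s).toAddSubgroup = AddSubgroup.closure s :=
    Submodule.span_int_eq_addSubgroupClosure s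
  have hdisc' : DiscreteTopology (Submodule.span ℤ s) := by
    rw [← hL] at hdisc
    exact hdisc
  have e' : Submodule.span ℤ s ≃+ (Fin d → ℤ) := by
    rw [← hL] at e
    exact e
  apply Submodule.eq_top_of_finrank_eq
  have h := Real.finrank_eq_int_finrank_of_discrete hdisc'
  rw [Set.finrank, Set.finrank, e'.toIntLinearEquiv.finrank_eq] at h
  simpa [hd] using h

/-- The normal form of a word in the maps `x ↦ g⁻¹ (s k x + v k)`: conjugating by powers of `g`
turns it into an isometry whose linear part lies in the group generated by the `s k` and whose
translation part lies in `L`. -/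
lemma exists_iterate_wordComp_eq {m : ℕ} {g : E ≃ₗ[ℝ] E} {s : Fin m → E ≃ₗᵢ[ℝ] E} {v : Fin m → E}
    {f : Fin m → E → E} (hf : ∀ k x, f k x = g.symm (s k x + v k))
    {S : Subgroup (E ≃ₗᵢ[ℝ] E)} {L : AddSubgroup E} (hs : ∀ k, s k ∈ S) (hv : ∀ k, v k ∈ L)
    (hgL : ∀ x ∈ L, g x ∈ L) (hSL : ∀ σ ∈ S, ∀ x ∈ L, σ x ∈ L)
    (hcomm : ∀ σ ∈ S, ∃ σ' ∈ S, ∀ x, g (σ x) = σ' (g x)) (w : List (Fin m)) :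
    ∃ σ ∈ S, ∃ t ∈ L, ∀ x, g^[w.length] (wordComp f w x) = σ x + t := by
  have hcomm' : ∀ n : ℕ, ∀ σ ∈ S, ∃ σ' ∈ S, ∀ x, g^[n] (σ x) = σ' (g^[n] x) := by
    intro n
    induction n with
    | zero => exact fun σ hσ => ⟨σ, hσ, fun x => rfl⟩
    | succ n ih =>
      intro σ hσ
      obtain ⟨σ₁, h₁, e₁⟩ := hcomm σ hσ
      obtain ⟨σ₂, h₂, e₂⟩ := ih σ₁ h₁
      exact ⟨σ₂, h₂, fun x => by rw [Function.iterate_succ_apply, e₁, e₂,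
        Function.iterate_succ_apply]⟩
  have hgL' : ∀ n : ℕ, ∀ x ∈ L, g^[n] x ∈ L := fun n x hx =>
    Set.MapsTo.iterate (s := (L : Set E)) hgL n hx
  induction w with
  | nil => exact ⟨1, S.one_mem, 0, L.zero_mem, fun x => by simp [wordComp]⟩
  | cons i w ih =>
    obtain ⟨σ, hσ, t, ht, e⟩ := ih
    obtain ⟨σ', hσ', e'⟩ := hcomm' w.length (s i) (hs i)
    refine ⟨σ' * σ, S.mul_mem hσ' hσ, σ' t + g^[w.length] (v i),
      L.add_mem (hSL σ' hσ' t ht) (hgL' _ _ (hv i)), fun x => ?_⟩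
    rw [List.length_cons, Function.iterate_succ_apply, wordComp, Function.comp_apply, hf,
      LinearEquiv.apply_symm_apply, iterate_map_add, e', e, map_add, add_assoc]
    rfl

/-- A word of length `n` in maps scaling distances by `r` scales distances by `r ^ n`. -/
lemma dist_wordComp {X : Type*} [PseudoMetricSpace X] {m : ℕ} {f : Fin m → X → X} {r : ℝ}
    (hf : ∀ k x y, dist (f k x) (f k y) = r * dist x y) (w : List (Fin m)) (x y : X) :
    dist (wordComp f w x) (wordComp f w y) = r ^ w.length * dist x y := by
  induction w with
  | nil => simp [wordComp]
  | cons i w ih =>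
    rw [wordComp, Function.comp_apply, Function.comp_apply, hf, ih, List.length_cons, pow_succ]
    ring

/-- A similitude whose ratio is a quotient `r ^ b / r ^ a` with `a ≠ b` stays at
distance at least `1 - r` from the identity on the unit ball. -/
lemma one_sub_le_of_dist_eq [Nontrivial E] {φ : E → E} {r M : ℝ} (hr0 : 0 < r) (hr1 : r < 1)
    {a b : ℕ} (hab : a ≠ b) (hφ : ∀ x y, r ^ a * dist (φ x) (φ y) = r ^ b * dist x y)
    (hM : ∀ x, ‖x‖ ≤ 1 → ‖φ x - x‖ ≤ M) : 1 - r ≤ M := by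
  obtain ⟨e, he⟩ := exists_norm_eq E zero_le_one
  have h₁ := hM e he.le
  have h₂ := hM (-e) (by rw [norm_neg, he])
  have hd : dist e (-e) = 2 := by
    rw [dist_eq_norm, sub_neg_eq_add, ← two_smul ℝ, norm_smul, he]
    norm_num
  have h := hφ e (-e)
  rw [← dist_eq_norm] at h₁ h₂
  have hup : dist (φ e) (φ (-e)) ≤ 2 + 2 * M := by
    have := dist_triangle4 (φ e) e (-e) (φ (-e))
    rw [dist_comm (-e)] at this
    linarith
  have hlow : 2 ≤ dist (φ e) (φ (-e)) + 2 * M := by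
    have := dist_triangle4 e (φ e) (φ (-e)) (-e)
    rw [dist_comm e (φ e)] at this
    linarith
  rw [hd] at h
  have key : ∀ k, r ^ (k + 1) ≤ r := fun k => by
    rw [pow_succ]
    exact mul_le_of_le_one_left hr0.le (pow_le_one₀ hr0.le hr1.le)
  have hM0 : 0 ≤ M := dist_nonneg.trans h₁
  rcases lt_or_gt_of_ne hab with hlt | hlt
  · obtain ⟨k, rfl⟩ := Nat.exists_eq_add_of_lt hlt
    rw [add_assoc, pow_add, mul_assoc] at h
    have := mul_left_cancel₀ (pow_pos hr0 a).ne' h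
    linarith [key k]
  · obtain ⟨k, rfl⟩ := Nat.exists_eq_add_of_lt hlt
    rw [add_assoc, pow_add, mul_assoc] at h
    have := mul_left_cancel₀ (pow_pos hr0 b).ne' h
    nlinarith [mul_le_mul_of_nonneg_right (key k) (dist_nonneg (x := φ e) (y := φ (-e)))]

/-- If `σ ∘ φ + t = τ + t'` for linear isometries `σ, τ` preserving `L` and `t, t' ∈ L`, and `φ`
is close to the identity on the unit ball, then `φ` is the identity. -/
lemma eq_id_of_close {L : AddSubgroup E} {s : Set E} {δ R M : ℝ}
    (hδ : ∀ x ∈ L, ‖x‖ < δ → x = 0) (hsL : s ⊆ L) (hspan : Submodule.span ℝ s = ⊤)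
    (hR : ∀ x ∈ s, ‖x‖ ≤ R) {φ : E → E} {σ τ : E ≃ₗᵢ[ℝ] E} {t t' : E}
    (hσ : ∀ x ∈ L, σ x ∈ L) (hτ : ∀ x ∈ L, τ x ∈ L) (ht : t ∈ L) (ht' : t' ∈ L)
    (hφ : ∀ x, σ (φ x) + t = τ x + t') (hM : ∀ x, ‖x‖ ≤ 1 → ‖φ x - x‖ ≤ M)
    (hMδ : M < δ) (hMRδ : M * R < δ) : φ = id := by
  have h0 : t' - t = σ (φ 0) := by
    have := hφ 0
    rw [map_zero, zero_add] at this
    rw [← this, add_sub_cancel_right]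
  have htt : t' - t = 0 := by
    refine hδ _ (L.sub_mem ht' ht) ?_
    rw [h0, LinearIsometryEquiv.norm_map]
    exact lt_of_le_of_lt (by simpa using hM 0 (by simp)) hMδ
  rw [sub_eq_zero] at htt
  subst htt
  have hφ' : ∀ x, σ (φ x) = τ x := fun x => add_right_cancel (hφ x)
  have hM0 : 0 ≤ M := (norm_nonneg _).trans (hM 0 (by simp))
  have hnorm : ∀ x, ‖τ x - σ x‖ ≤ M * ‖x‖ := by
    let T : E →L[ℝ] E := (τ : E →L[ℝ] E) - (σ : E →L[ℝ] E)
    have hT : ‖T‖ ≤ M := by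
      refine ContinuousLinearMap.opNorm_le_of_unit_norm hM0 fun x hx => ?_
      change ‖τ x - σ x‖ ≤ M
      rw [← hφ', ← map_sub, LinearIsometryEquiv.norm_map]
      exact hM x hx.le
    exact fun x => T.le_of_opNorm_le hT x
  have hs : Set.EqOn τ.toLinearEquiv.toLinearMap σ.toLinearEquiv.toLinearMap s := fun x hx => by
    refine sub_eq_zero.1 (hδ _ (L.sub_mem (hτ x (hsL hx)) (hσ x (hsL hx))) ?_)
    exact ((hnorm x).trans (mul_le_mul_of_nonneg_left (hR x hx) hM0)).trans_lt hMRδ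
  funext x
  have hx : τ x = σ x := LinearMap.eqOn_span hs (hspan ▸ Submodule.mem_top)
  exact σ.injective ((hφ' x).trans hx)

/-- The displacement of a map with `a * dist (φ x) (φ y) = b * dist x y`, `0 < a`,
on the unit ball is bounded. -/
lemma bddAbove_range_norm_sub {E : Type*} [NormedAddCommGroup E] {φ : E → E} {a b : ℝ}
    (ha : 0 < a) (hb : 0 ≤ b)
    (hφ : ∀ x y, a * dist (φ x) (φ y) = b * dist x y) :
    BddAbove (Set.range fun x : Metric.closedBall (0 : E) 1 => ‖φ x - x‖) := by
  refine ⟨b / a + ‖φ 0‖ + 1, ?_⟩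
  rintro _ ⟨⟨x, hx⟩, rfl⟩
  have hx1 : ‖x‖ ≤ 1 := by simpa using hx
  have h₁ : ‖φ x - φ 0‖ ≤ b / a := by
    rw [le_div_iff₀ ha, mul_comm, ← dist_eq_norm, hφ, dist_zero_right]
    exact mul_le_of_le_one_right hb hx1
  have h₂ : ‖φ x‖ ≤ ‖φ x - φ 0‖ + ‖φ 0‖ := norm_le_norm_sub_add _ _
  linarith [norm_sub_le (φ x) x]

end


/-- **Zerner's theorem: crystallographic data imply the weak separation condition.**
Let `g` be an expanding linear similitude of `ℝ^d` with factor `1/r`, let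
`h k x = s k x + v k` with `s k` linear isometries and `h 0 = id`, and let
`F = {g⁻¹ ∘ h k}` be the resulting IFS of ratio `r` with attractor `A`.
If the data are crystallographic — the subgroup `L` generated by the `v k` is discrete
and isomorphic to `ℤ^d`, `g` and the `s k` map `L` into itself, and the group `S`
generated by the `s k` commutes with `g` — then the weak separation condition holds:
some `ε > 0` bounds from below the distance (sup on the closed unit ball) from the
identity of every neighbor map `h = f⁻¹ ∘ g'` (`f, g'` finite nonempty compositions
of maps of `F`) other than the identity. -/
theorem wsc_of_crystallographic_data
    (d : ℕ) (r : ℝ) (hr0 : 0 < r) (hr1 : r < 1)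
    (g : EuclideanSpace ℝ (Fin d) ≃ₗ[ℝ] EuclideanSpace ℝ (Fin d))
    (hg : ∀ x y : EuclideanSpace ℝ (Fin d), dist (g x) (g y) = (1 / r) * dist x y)
    (m : ℕ) (hm : 0 < m)
    (s : Fin m → (EuclideanSpace ℝ (Fin d) ≃ₗᵢ[ℝ] EuclideanSpace ℝ (Fin d)))
    (v : Fin m → EuclideanSpace ℝ (Fin d))
    (h : Fin m → EuclideanSpace ℝ (Fin d) → EuclideanSpace ℝ (Fin d))
    (hh : ∀ k x, h k x = s k x + v k)
    (hs0 : s ⟨0, hm⟩ = LinearIsometryEquiv.refl ℝ (EuclideanSpace ℝ (Fin d)))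
    (hv0 : v ⟨0, hm⟩ = 0)
    (f : Fin m → EuclideanSpace ℝ (Fin d) → EuclideanSpace ℝ (Fin d))
    (hf : ∀ k x, f k x = g.symm (h k x))
    (A : Set (EuclideanSpace ℝ (Fin d))) (hAne : A.Nonempty) (hAcp : IsCompact A)
    (hA : A = ⋃ k, f k '' A)
    -- crystallographic data:
    (hLdisc : DiscreteTopology (AddSubgroup.closure (Set.range v) : AddSubgroup (EuclideanSpace ℝ (Fin d))))
    (hLfree : Nonempty ((AddSubgroup.closure (Set.range v) : AddSubgroup (EuclideanSpace ℝ (Fin d))) ≃+ (Fin d → ℤ)))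
    (hgL : ∀ x ∈ AddSubgroup.closure (Set.range v), g x ∈ AddSubgroup.closure (Set.range v))
    (hsL : ∀ k, ∀ x ∈ AddSubgroup.closure (Set.range v), s k x ∈ AddSubgroup.closure (Set.range v))
    (hcomm₁ : ∀ σ ∈ Subgroup.closure (Set.range s), ∃ σ' ∈ Subgroup.closure (Set.range s),
        ∀ x, g (σ x) = σ' (g x))
    (hcomm₂ : ∀ σ' ∈ Subgroup.closure (Set.range s), ∃ σ ∈ Subgroup.closure (Set.range s),
        ∀ x, σ' (g x) = g (σ x)) :
    ∃ ε > 0, ∀ hmap : EuclideanSpace ℝ (Fin d) → EuclideanSpace ℝ (Fin d),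
      (∃ u w : List (Fin m), u ≠ [] ∧ w ≠ [] ∧ wordComp f u ∘ hmap = wordComp f w) →
      hmap ≠ id →
      ε ≤ ⨆ x : Metric.closedBall (0 : EuclideanSpace ℝ (Fin d)) 1, ‖hmap x - x‖ := by
  set L := AddSubgroup.closure (Set.range v)
  have hf' : ∀ k x, f k x = g.symm (s k x + v k) := fun k x => by rw [hf, hh]
  have hdist : ∀ k x y, dist (f k x) (f k y) = r * dist x y := fun k x y => by
    have := hg (f k x) (f k y)
    rw [hf', hf', LinearEquiv.apply_symm_apply, LinearEquiv.apply_symm_apply, dist_add_right,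
      LinearIsometryEquiv.dist_map] at this
    rw [hf', hf', this]
    field_simp
  have hSL : ∀ σ ∈ Subgroup.closure (Set.range s), ∀ x ∈ L, σ x ∈ L := fun σ hσ =>
    LinearIsometryEquiv.mem_of_mem_closure (by rintro _ ⟨k, rfl⟩; exact hsL k) hσ
  have hvL : Set.range v ⊆ L := AddSubgroup.subset_closure
  have hspan : Submodule.span ℝ (Set.range v) = ⊤ := by
    obtain ⟨e⟩ := hLfree
    exact span_eq_top_of_discrete_of_equiv finrank_euclideanSpace_fin hLdisc e
  obtain ⟨δ, hδ0, hδ⟩ := L.exists_pos_forall_norm_lt_eq_zero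
  obtain ⟨R, hR⟩ := (Set.finite_range v).isBounded.exists_norm_le
  have hR0 : 0 ≤ R := (norm_nonneg _).trans (hR _ ⟨⟨0, hm⟩, rfl⟩)
  refine ⟨min (1 - r) (δ / (1 + R)), lt_min (by linarith) (by positivity), ?_⟩
  rintro φ ⟨u, w, -, -, huw⟩ hφ
  by_contra! hlt
  have : Nontrivial (EuclideanSpace ℝ (Fin d)) := by
    obtain ⟨x, hx⟩ := Function.ne_iff.1 hφ
    exact ⟨_, _, hx⟩
  have hsim : ∀ x y, r ^ u.length * dist (φ x) (φ y) = r ^ w.length * dist x y := fun x y => by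
    rw [← dist_wordComp hdist, ← dist_wordComp hdist, ← huw]
    rfl
  set M := ⨆ x : Metric.closedBall (0 : EuclideanSpace ℝ (Fin d)) 1, ‖φ x - x‖
  have hM : ∀ x, ‖x‖ ≤ 1 → ‖φ x - x‖ ≤ M := fun x hx =>
    le_ciSup (bddAbove_range_norm_sub (pow_pos hr0 _) (pow_pos hr0 _).le hsim)
      (⟨x, by simpa using hx⟩ : Metric.closedBall (0 : EuclideanSpace ℝ (Fin d)) 1)
  obtain ⟨hM₁, hM₂⟩ := lt_min_iff.1 hlt
  have hlen : u.length = w.length := by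
    by_contra hne
    exact hM₁.not_ge (one_sub_le_of_dist_eq hr0 hr1 hne hsim hM)
  have hform := exists_iterate_wordComp_eq hf'
    (fun k => Subgroup.subset_closure (Set.mem_range_self k)) (fun k => hvL (Set.mem_range_self k))
    hgL hSL hcomm₁
  obtain ⟨σ, hσ, t, ht, eσ⟩ := hform u
  obtain ⟨τ, hτ, t', ht', eτ⟩ := hform w
  have hM0 : 0 ≤ M := (norm_nonneg _).trans (hM 0 (by simp))
  rw [lt_div_iff₀ (by positivity)] at hM₂
  refine hφ (eq_id_of_close hδ hvL hspan hR (hSL σ hσ) (hSL τ hτ) ht ht' (fun x => ?_) hM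
    (by nlinarith) (by nlinarith))
  rw [← eσ, ← eτ, ← huw, hlen]
  rfl
end

section
/- Let F be an IFS with equal ratio r on ℝ^d with attractor A, assume 0 ∈ A, and let V be a bounded open subset of ℝ^d with A ⊆ V. Then F is of finite type (the set of proper neighbor maps is finite) if and only if the set of Ngai–Wang neighbor maps with respect to V, namely {f⁻¹∘g : n ≥ 1, f, g ∈ F^n, f(V) ∩ g(V) ≠ ∅}, is finite. -/
/-- Neighbor maps of the IFS `F = {f 1, …, f m}`: maps `h = f⁻¹ ∘ g` with
`f, g ∈ F^n` for some `n ≥ 1`, encoded by the equation `f ∘ h = g`. -/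
def neighborMaps {E : Type*} {m : ℕ} (f : Fin m → E → E) : Set (E → E) :=
  {h | ∃ u w : List (Fin m), u ≠ [] ∧ u.length = w.length ∧
      wordComp f u ∘ h = wordComp f w}

theorem surjective_of_dist_eq_mul {E : Type*} [NormedAddCommGroup E] [InnerProductSpace ℝ E]
    [FiniteDimensional ℝ E] {r : ℝ} (hr : 0 < r) {g : E → E}
    (hg : ∀ x y, dist (g x) (g y) = r * dist x y) : Function.Surjective g := by
  have hiso : Isometry (fun x => r⁻¹ • g x) := Isometry.of_dist_eq fun x y => by
    rw [dist_smul₀, hg, Real.norm_of_nonneg (inv_nonneg.2 hr.le), inv_mul_cancel_left₀ hr.ne']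
  have hsurj : Function.Surjective (fun x => r⁻¹ • g x) := by
    set φ := hiso.affineIsometryOfStrictConvexSpace
    have h1 : Function.Surjective φ.linear :=
      LinearMap.surjective_of_injective φ.linearIsometry.injective
    have h2 : Function.Surjective φ := (AffineMap.linear_surjective_iff φ.toAffineMap).1 h1
    exact h2
  intro y
  obtain ⟨x, hx⟩ := hsurj (r⁻¹ • y)
  exact ⟨x, smul_right_injective E (inv_ne_zero hr.ne') hx⟩

theorem wordComp_append {E : Type*} {m : ℕ} (f : Fin m → E → E) (u w : List (Fin m)) :
    wordComp f (u ++ w) = wordComp f u ∘ wordComp f w := by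
  induction u with
  | nil => rfl
  | cons i u ih => simp [wordComp, ih, Function.comp_assoc]

/-- The permutations `(F i)⁻¹ * p * F j` with `p ∈ S`. -/
def descendants {E ι : Type*} (F : ι → Equiv.Perm E) (S : Set (Equiv.Perm E)) :
    Set (Equiv.Perm E) :=
  (fun x : (ι × ι) × Equiv.Perm E => (F x.1.1)⁻¹ * x.2 * F x.1.2) '' (Set.univ ×ˢ S)

theorem mem_descendants {E ι : Type*} (F : ι → Equiv.Perm E) {S : Set (Equiv.Perm E)}
    {p : Equiv.Perm E} (hp : p ∈ S) (i j : ι) : (F i)⁻¹ * p * F j ∈ descendants F S :=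
  ⟨((i, j), p), ⟨Set.mem_univ _, hp⟩, rfl⟩

theorem finite_descendants {E ι : Type*} [Finite ι] (F : ι → Equiv.Perm E)
    {S : Set (Equiv.Perm E)} (hS : S.Finite) : (descendants F S).Finite :=
  (Set.finite_univ.prod hS).image _

theorem finite_iterate_descendants {E ι : Type*} [Finite ι] (F : ι → Equiv.Perm E)
    {S : Set (Equiv.Perm E)} (hS : S.Finite) (k : ℕ) : ((descendants F)^[k] S).Finite := by
  induction k with
  | zero => exact hS
  | succ k ih =>
    rw [Function.iterate_succ_apply']
    exact finite_descendants F ih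

theorem IsCompact.exists_pos_le_dist_of_finite {E : Type*} [MetricSpace E] {A : Set E}
    (hA : IsCompact A) {Q : Set (Equiv.Perm E)} (hQ : Q.Finite) :
    ∃ δ > 0, ∀ q ∈ Q, Isometry q → ¬ (A ∩ q '' A).Nonempty →
      ∀ a ∈ A, ∀ b ∈ A, δ ≤ dist a (q b) := by
  have h : ∀ᶠ δ : ℝ in nhdsWithin 0 (Set.Ioi 0), ∀ q ∈ Q, Isometry q → ¬ (A ∩ q '' A).Nonempty →
      ∀ a ∈ A, ∀ b ∈ A, δ ≤ dist a (q b) := by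
    rw [Filter.eventually_all_finite hQ]
    intro q _
    by_cases hq : Isometry q ∧ ¬ (A ∩ q '' A).Nonempty
    · obtain ⟨ε, hε, H⟩ := Metric.exists_pos_forall_lt_edist hA
        (hA.image hq.1.continuous).isClosed
        (Set.disjoint_iff_inter_eq_empty.2 (Set.not_nonempty_iff_eq_empty.1 hq.2))
      filter_upwards [Ioo_mem_nhdsGT (show (0 : ℝ) < ε from hε)] with δ hδ _ _ a ha b hb
      have h1 := H a ha (q b) ⟨b, hb, rfl⟩
      rw [edist_nndist, ENNReal.coe_lt_coe, ← NNReal.coe_lt_coe, coe_nndist] at h1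
      exact (hδ.2.trans h1).le
    · exact Filter.Eventually.of_forall fun δ h1 h2 => absurd ⟨h1, h2⟩ hq
  obtain ⟨δ, h1, h2⟩ := (h.and self_mem_nhdsWithin).exists
  exact ⟨δ, h2, h1⟩

/-- Any pair of words of equal length defines a neighbor map which is either proper or the
identity, or else has split off from such a map `k + 1` letters ago and has since moved away from
the attractor at rate `r⁻¹` per letter. -/
theorem exists_neighborMap_dichotomy {E : Type*} [MetricSpace E] {m : ℕ} {r δ : ℝ}
    (hr : 0 < r) {f : Fin m → E → E} (hsim : ∀ k x y, dist (f k x) (f k y) = r * dist x y)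
    {A : Set E} (hmaps : ∀ k, ∀ a ∈ A, f k a ∈ A)
    {F : Fin m → Equiv.Perm E} (hF : ∀ k x, F k x = f k x) {P : Set (Equiv.Perm E)}
    (hP1 : 1 ∈ P)
    (hP : ∀ p : Equiv.Perm E, ⇑p ∈ neighborMaps f → (A ∩ p '' A).Nonempty → p ∈ P)
    (hδ : ∀ q ∈ descendants F P, Isometry q → ¬ (A ∩ q '' A).Nonempty →
      ∀ a ∈ A, ∀ b ∈ A, δ ≤ dist a (q b))
    (n : ℕ) (u w : List (Fin m)) (hu : u.length = n) (hw : w.length = n) :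
    ∃ p : Equiv.Perm E, wordComp f u ∘ p = wordComp f w ∧ Isometry p ∧
      (p ∈ P ∨ ∃ k : ℕ, p ∈ (descendants F)^[k + 1] P ∧
        ∀ a ∈ A, ∀ b ∈ A, δ * r⁻¹ ^ k ≤ dist a (p b)) := by
  induction n generalizing u w with
  | zero =>
    rw [List.length_eq_zero_iff] at hu hw
    subst hu hw
    exact ⟨1, rfl, isometry_id, Or.inl hP1⟩
  | succ n ih =>
    obtain ⟨u, i, rfl⟩ := List.eq_nil_or_concat' u |>.resolve_left (by rintro rfl; simp at hu)
    obtain ⟨w, j, rfl⟩ := List.eq_nil_or_concat' w |>.resolve_left (by rintro rfl; simp at hw)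
    obtain ⟨p, hp, hiso, hcase⟩ := ih u w (by simpa using hu) (by simpa using hw)
    have hq : ∀ x, f i (((F i)⁻¹ * p * F j) x) = p (f j x) := fun x => by
      rw [← hF, ← hF]
      simp
    have hdist : ∀ x y, dist x (((F i)⁻¹ * p * F j) y) = r⁻¹ * dist (f i x) (p (f j y)) :=
      fun x y => by rw [← hq, hsim, inv_mul_cancel_left₀ hr.ne']
    have hqiso : Isometry ((F i)⁻¹ * p * F j) := Isometry.of_dist_eq fun x y => by
      rw [hdist, hq, hiso.dist_eq, hsim, inv_mul_cancel_left₀ hr.ne']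
    have hcomp : wordComp f (u ++ [i]) ∘ ((F i)⁻¹ * p * F j) = wordComp f (w ++ [j]) := by
      rw [wordComp_append, wordComp_append, ← hp]
      funext x
      simp only [wordComp, Function.comp_apply, id]
      rw [hq]
    refine ⟨_, hcomp, hqiso, ?_⟩
    rcases hcase with hpP | ⟨k, hpk, hk⟩
    · by_cases hne : (A ∩ ((F i)⁻¹ * p * F j : Equiv.Perm E) '' A).Nonempty
      · exact Or.inl (hP _ ⟨u ++ [i], w ++ [j], by simp, by rw [hu, hw], hcomp⟩ hne)
      · refine Or.inr ⟨0, mem_descendants F hpP i j, ?_⟩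
        simpa using hδ _ (mem_descendants F hpP i j) hqiso hne
    · refine Or.inr ⟨k + 1, ?_, fun a ha b hb => ?_⟩
      · rw [Function.iterate_succ_apply']
        exact mem_descendants F hpk i j
      · rw [hdist, pow_succ, ← mul_assoc, mul_comm _ r⁻¹]
        exact mul_le_mul_of_nonneg_left (hk _ (hmaps i a ha) _ (hmaps j b hb))
          (inv_nonneg.2 hr.le)

theorem injective_wordComp {E : Type*} {m : ℕ} {f : Fin m → E → E}
    (hf : ∀ k, Function.Injective (f k)) (u : List (Fin m)) :
    Function.Injective (wordComp f u) := by
  induction u with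
  | nil => exact Function.injective_id
  | cons i u ih => exact (hf i).comp ih

/-- **Equivalence of the Bandt–Mesing and Ngai–Wang finite type conditions.**
Let `F` be an IFS with equal ratio `r` on `ℝ^d` with attractor `A ∋ 0`, and let `V` be
a bounded open set containing `A`. Then `F` has finitely many proper neighbor maps
(maps `h = f⁻¹ ∘ g` with `f, g ∈ F^n`, `n ≥ 1`, and `A ∩ h(A) ≠ ∅`) if and only if
there are finitely many Ngai–Wang neighbor maps with respect to `V`
(maps `h = f⁻¹ ∘ g` with `f, g ∈ F^n`, `n ≥ 1`, and `f(V) ∩ g(V) ≠ ∅`). -/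
theorem finiteType_iff_ngaiWang_finiteType
    (d : ℕ) (r : ℝ) (hr0 : 0 < r) (hr1 : r < 1)
    (m : ℕ) (hm : 0 < m)
    (f : Fin m → EuclideanSpace ℝ (Fin d) → EuclideanSpace ℝ (Fin d))
    (hsim : ∀ k x y, dist (f k x) (f k y) = r * dist x y)
    (A : Set (EuclideanSpace ℝ (Fin d))) (hAne : A.Nonempty) (hAcp : IsCompact A)
    (hA : A = ⋃ k, f k '' A) (h0A : (0 : EuclideanSpace ℝ (Fin d)) ∈ A)
    (V : Set (EuclideanSpace ℝ (Fin d))) (hVopen : IsOpen V)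
    (hVbdd : Bornology.IsBounded V) (hAV : A ⊆ V) :
    {h | h ∈ neighborMaps f ∧ (A ∩ h '' A).Nonempty}.Finite ↔
      {h : EuclideanSpace ℝ (Fin d) → EuclideanSpace ℝ (Fin d) |
        ∃ u w : List (Fin m), u ≠ [] ∧ u.length = w.length ∧
          wordComp f u ∘ h = wordComp f w ∧
          (wordComp f u '' V ∩ wordComp f w '' V).Nonempty}.Finite := by
  have hinj : ∀ k, Function.Injective (f k) := fun k x y hxy => by
    have h := hsim k x y
    rw [hxy, dist_self, zero_eq_mul] at h
    exact dist_eq_zero.1 (h.resolve_left hr0.ne')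
  constructor
  · intro hfin
    let F : Fin m → Equiv.Perm (EuclideanSpace ℝ (Fin d)) := fun k =>
      Equiv.ofBijective (f k) ⟨hinj k, surjective_of_dist_eq_mul hr0 (hsim k)⟩
    let P : Set (Equiv.Perm (EuclideanSpace ℝ (Fin d))) :=
      insert 1 (DFunLike.coe ⁻¹' {h | h ∈ neighborMaps f ∧ (A ∩ h '' A).Nonempty})
    have hPfin : P.Finite :=
      (hfin.preimage (DFunLike.coe_injective.injOn)).insert 1
    have hmaps : ∀ k, ∀ a ∈ A, f k a ∈ A := fun k a ha => by
      rw [hA]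
      exact Set.mem_iUnion.2 ⟨k, a, ha, rfl⟩
    obtain ⟨δ, hδ0, hδ⟩ := hAcp.exists_pos_le_dist_of_finite (finite_descendants F hPfin)
    obtain ⟨D, hD⟩ := hVbdd.subset_closedBall 0
    obtain ⟨K, hK⟩ := pow_unbounded_of_one_lt ((D + D) / δ) (one_lt_inv₀ hr0 |>.2 hr1)
    have hfinal : (P ∪ ⋃ k ∈ Set.Iio K, (descendants F)^[k + 1] P).Finite :=
      hPfin.union ((Set.finite_Iio K).biUnion fun k _ =>
        finite_iterate_descendants F hPfin (k + 1))
    refine (hfinal.image DFunLike.coe).subset ?_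
    rintro h ⟨u, w, -, hlen, hcomp, hne⟩
    obtain ⟨p, hp, hiso, hcase⟩ := exists_neighborMap_dichotomy hr0 hsim hmaps (F := F)
      (fun _ _ => rfl) (P := P) (Set.mem_insert _ _)
      (fun p h1 h2 => Set.mem_insert_of_mem _ ⟨h1, h2⟩) hδ _ u w rfl hlen.symm
    have hph : ⇑p = h := (injective_wordComp hinj u).comp_left (hp.trans hcomp.symm)
    refine ⟨p, ?_, hph⟩
    rcases hcase with hpP | ⟨k, hpk, hk⟩
    · exact Or.inl hpP
    · refine Or.inr (Set.mem_biUnion (show k < K from ?_) hpk)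
      obtain ⟨_, ⟨v, hv, rfl⟩, v', hv', hvv⟩ := hne
      rw [← hp] at hvv
      have hvp : p v' = v := injective_wordComp hinj u hvv
      have hle : δ * r⁻¹ ^ k ≤ D + D := by
        calc δ * r⁻¹ ^ k ≤ dist 0 (p 0) := hk 0 h0A 0 h0A
          _ ≤ dist 0 v + dist v (p 0) := dist_triangle _ _ _
          _ = dist v 0 + dist v' 0 := by
            conv_lhs => rw [dist_comm 0 v]; arg 2; rw [← hvp, hiso.dist_eq]
          _ ≤ D + D := add_le_add (hD hv) (hD hv')
      have hlt : r⁻¹ ^ k < r⁻¹ ^ K :=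
        ((le_div_iff₀' hδ0).2 hle).trans_lt hK
      exact (pow_lt_pow_iff_right₀ (one_lt_inv₀ hr0 |>.2 hr1)).1 hlt
  · intro hfin
    refine hfin.subset ?_
    rintro h ⟨⟨u, w, hu, hlen, hcomp⟩, a, ha, b, hb, hab⟩
    refine ⟨u, w, hu, hlen, hcomp, wordComp f u a, ⟨a, hAV ha, rfl⟩, b, hAV hb, ?_⟩
    rw [← hcomp, Function.comp_apply, hab]
end

section
/- Let t = (√5 − 1)/2 and consider the IFS F = {f, g} on ℝ with f(x) = t x and g(x) = t x + 1 − t. Then the attractor of F is the interval [0,1], and the set of proper neighbor maps of F is exactly the set of seven translations {x ↦ x + c : c ∈ {0, 1, −1, t, −t, t², −t²}}. -/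
/-- Word composition turns concatenation into composition. -/
lemma wordComp_append_singleton {E : Type*} {m : ℕ} (f : Fin m → E → E) (u : List (Fin m))
    (i : Fin m) : wordComp f (u ++ [i]) = wordComp f u ∘ f i := by
  induction u with
  | nil => rfl
  | cons j u ih => simp [wordComp, ih, Function.comp_assoc]

/-- One step of the neighbor graph: the seven translation lengths are closed under
`c ↦ c / t + d t`, `d ∈ {-1, 0, 1}`, up to lengths exceeding the diameter of the attractor. -/
lemma neighbor_step {t c d : ℝ} (hquad : t ^ 2 = 1 - t) (hlow : 1 / 2 < t)
    (hc : c ∈ ({0, 1, -1, t, -t, t ^ 2, -t ^ 2} : Set ℝ) ∨ 1 < |c|)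
    (hd : d = -1 ∨ d = 0 ∨ d = 1) :
    c * (1 + t) + d * t ∈ ({0, 1, -1, t, -t, t ^ 2, -t ^ 2} : Set ℝ) ∨
      1 < |c * (1 + t) + d * t| := by
  simp only [hquad, Set.mem_insert_iff, Set.mem_singleton_iff, lt_abs] at hc ⊢
  rcases hc with (h | h | h | h | h | h | h) | h | h <;> rcases hd with rfl | rfl | rfl <;>
    first
      | exact Or.inr (Or.inl (by nlinarith))
      | exact Or.inr (Or.inr (by nlinarith))
      | (left; subst_vars; grind)

/-- Two words of equal length act as `x ↦ a x + b` and `x ↦ a (x + c) + b`, where `c` is one of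
the seven translation lengths or exceeds `1` in absolute value. -/
lemma exists_wordComp_eq {t : ℝ} (hquad : t ^ 2 = 1 - t) (hlow : 1 / 2 < t)
    {f : Fin 2 → ℝ → ℝ} (hf0 : f 0 = fun x => t * x) (hf1 : f 1 = fun x => t * x + (1 - t))
    (n : ℕ) (u w : List (Fin 2)) (hu : u.length = n) (hw : w.length = n) :
    ∃ a b c : ℝ, 0 < a ∧ (∀ x, wordComp f u x = a * x + b) ∧
      (∀ x, wordComp f w x = a * (x + c) + b) ∧
      (c ∈ ({0, 1, -1, t, -t, t ^ 2, -t ^ 2} : Set ℝ) ∨ 1 < |c|) := by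
  induction n generalizing u w with
  | zero =>
    obtain rfl := List.length_eq_zero_iff.1 hu
    obtain rfl := List.length_eq_zero_iff.1 hw
    exact ⟨1, 0, 0, one_pos, by simp [wordComp], by simp [wordComp], by simp⟩
  | succ n ih =>
    obtain rfl | ⟨u, i, rfl⟩ := List.eq_nil_or_concat' u
    · simp at hu
    obtain rfl | ⟨w, j, rfl⟩ := List.eq_nil_or_concat' w
    · simp at hw
    obtain ⟨a, b, c, ha, hau, haw, hc⟩ := ih u w (by simpa using hu) (by simpa using hw)
    have hf : ∀ k : Fin 2, ∀ x, f k x = t * x + (k : ℕ) * (1 - t) := by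
      intro k x
      fin_cases k <;> simp [hf0, hf1]
    have hd : ((j : ℕ) : ℝ) - (i : ℕ) = -1 ∨ ((j : ℕ) : ℝ) - (i : ℕ) = 0 ∨
        ((j : ℕ) : ℝ) - (i : ℕ) = 1 := by
      fin_cases i <;> fin_cases j <;> simp
    refine ⟨a * t, a * ((i : ℕ) * (1 - t)) + b, _, by positivity, fun x => ?_, fun x => ?_,
      neighbor_step hquad hlow hc hd⟩
    · rw [wordComp_append_singleton, Function.comp_apply, hau, hf]
      ring
    · rw [wordComp_append_singleton, Function.comp_apply, haw, hf]
      linear_combination (-a * c - a * (((j : ℕ) : ℝ) - (i : ℕ))) * hquad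

/-- **The golden mean Bernoulli convolution IFS has exactly seven proper neighbor
maps.** For `t = (√5 − 1)/2` and the IFS `{x ↦ t x, x ↦ t x + 1 − t}` on `ℝ`, the
attractor is `[0,1]`, and the proper neighbor maps are exactly the seven translations
`x ↦ x + c` with `c ∈ {0, 1, −1, t, −t, t², −t²}`. -/
theorem golden_bernoulli_seven_neighbors
    (t : ℝ) (ht : t = (Real.sqrt 5 - 1) / 2)
    (f : Fin 2 → ℝ → ℝ)
    (hf0 : f 0 = fun x => t * x)
    (hf1 : f 1 = fun x => t * x + (1 - t)) :
    (Set.Icc (0 : ℝ) 1 = f 0 '' Set.Icc 0 1 ∪ f 1 '' Set.Icc 0 1) ∧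
      {h | h ∈ neighborMaps f ∧ (Set.Icc (0 : ℝ) 1 ∩ h '' Set.Icc (0 : ℝ) 1).Nonempty}
        = {h : ℝ → ℝ | ∃ c ∈ ({0, 1, -1, t, -t, t ^ 2, -t ^ 2} : Set ℝ),
            h = fun x => x + c} := by
  have hsq : Real.sqrt 5 ^ 2 = 5 := Real.sq_sqrt (by norm_num)
  have hquad : t ^ 2 = 1 - t := by rw [ht]; linear_combination hsq / 4
  have hlow : 1 / 2 < t := by
    have : 2 < Real.sqrt 5 := Real.lt_sqrt_of_sq_lt (by norm_num)
    linarith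
  have hlt : t < 1 := by nlinarith
  refine ⟨?_, ?_⟩
  · ext x
    simp only [hf0, hf1, Set.mem_union, Set.mem_image, Set.mem_Icc]
    constructor
    · rintro ⟨h0, h1⟩
      rcases le_total x t with h | h
      · exact Or.inl ⟨x / t, ⟨by positivity, (div_le_one (by linarith)).2 h⟩, by field_simp⟩
      · refine Or.inr ⟨(x - (1 - t)) / t, ⟨div_nonneg (by linarith) (by linarith),
          (div_le_one (by linarith)).2 (by linarith)⟩, by field_simp; ring⟩
    · rintro (⟨y, ⟨h0, h1⟩, rfl⟩ | ⟨y, ⟨h0, h1⟩, rfl⟩) <;> constructor <;> nlinarith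
  · ext h
    simp only [Set.mem_ofPred_eq]
    constructor
    · rintro ⟨⟨u, w, -, hlen, hcomp⟩, ⟨_, hy, x, hx, rfl⟩⟩
      obtain ⟨a, b, c, ha, hau, haw, hc⟩ :=
        exists_wordComp_eq hquad hlow hf0 hf1 _ u w rfl hlen.symm
      have hh : ∀ x, h x = x + c := fun x => by
        have := congrFun hcomp x
        rw [Function.comp_apply, hau, haw] at this
        exact mul_left_cancel₀ ha.ne' (add_right_cancel this)
      rw [hh] at hy
      refine ⟨c, hc.resolve_right (not_lt.2 (abs_le.2 ?_)), funext hh⟩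
      constructor <;> linarith [hx.1, hx.2, hy.1, hy.2]
    · rintro ⟨c, hc, rfl⟩
      constructor
      · have hpair : ∀ u w : List (Fin 2), u ≠ [] → u.length = w.length →
            (∀ x, wordComp f u (x + c) = wordComp f w x) → (fun x => x + c) ∈ neighborMaps f :=
          fun u w hu hlen hx => ⟨u, w, hu, hlen, funext hx⟩
        rcases hc with rfl | rfl | rfl | rfl | rfl | rfl | rfl
        · exact hpair [0] [0] (by simp) rfl fun x => by simp
        · refine hpair [0, 0] [1, 0] (by simp) rfl fun x => ?_
          simp only [wordComp, Function.comp_apply, hf0, hf1, id]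
          linear_combination hquad
        · refine hpair [1, 0] [0, 0] (by simp) rfl fun x => ?_
          simp only [wordComp, Function.comp_apply, hf0, hf1, id]
          linear_combination -hquad
        · refine hpair [0] [1] (by simp) rfl fun x => ?_
          simp only [wordComp, Function.comp_apply, hf0, hf1, id]
          linear_combination hquad
        · refine hpair [1] [0] (by simp) rfl fun x => ?_
          simp only [wordComp, Function.comp_apply, hf0, hf1, id]
          linear_combination -hquad
        · refine hpair [0, 1] [1, 0] (by simp) rfl fun x => ?_
          simp only [wordComp, Function.comp_apply, hf0, hf1, id]
          linear_combination (t ^ 2 + 1 - t) * hquad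
        · refine hpair [1, 0] [0, 1] (by simp) rfl fun x => ?_
          simp only [wordComp, Function.comp_apply, hf0, hf1, id]
          linear_combination -(t ^ 2 + 1 - t) * hquad
      · have hc1 : -1 ≤ c ∧ c ≤ 1 := by
          rcases hc with rfl | rfl | rfl | rfl | rfl | rfl | rfl <;> constructor <;> nlinarith
        rcases le_total 0 c with h0 | h0
        · exact ⟨c, ⟨h0, hc1.2⟩, 0, by simp, by simp⟩
        · exact ⟨0, by simp, -c, ⟨by linarith, by linarith⟩, by simp⟩
end
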